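/- arXiv:1404.4465 — 8 statements merged into one kernel-verified Lean document; each statement's English description precedes it below -/
import Mathlib

section
/- Let G = (V,E) be a finite directed graph and let order : V → ℕ be an injective function. Suppose G has the following 'contraction hierarchy' property: for all vertices u, v, w with (u,v) ∈ E and (v,w) ∈ E and order(v) < order(u) and order(v) < order(w), there exists a directed path from u to w in G all of whose vertices have order strictly greater than order(v). Then for all vertices s and t, s reaches t in G if and only if there exists a path ⟨s = u₁, …, u_k = m = w₁, …, w_ℓ = t⟩ in G such that order(u₁) < order(u₂) < ⋯ < order(u_k) and order(w₁) > order(w₂) > ⋯ > order(w_ℓ) (an 'up-down path'). -/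
open Relation in
/-- In a contraction hierarchy, the starts of up-down paths to `t` are closed under predecessors. -/
theorem exists_up_down_of_edge {V : Type*} [Finite V] {E : V → V → Prop} {order : V → ℕ}
    (horder : Function.Injective order)
    (hCH : ∀ u v w : V, E u v → E v w → order v < order u → order v < order w →
      ReflTransGen (fun a b => E a b ∧ order v < order a ∧ order v < order b) u w)
    {x y t : V} (hxy : E x y)
    (hyt : ∃ m, ReflTransGen (fun a b => E a b ∧ order a < order b) y m ∧
      ReflTransGen (fun a b => E a b ∧ order b < order a) m t) :
    ∃ m, ReflTransGen (fun a b => E a b ∧ order a < order b) x m ∧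
      ReflTransGen (fun a b => E a b ∧ order b < order a) m t := by
  have wf : WellFounded (fun a b : V => order b < order a) :=
    haveI : IsTrans V (fun a b => order b < order a) := ⟨fun _ _ _ h₁ h₂ => h₂.trans h₁⟩
    haveI : Std.Irrefl (fun a b : V => order b < order a) := ⟨fun _ => lt_irrefl _⟩
    Finite.wellFounded_of_trans_of_irrefl _
  induction y using wf.induction generalizing x with
  | _ y ih =>
    obtain ⟨m, hup, hdown⟩ := hyt
    rcases lt_trichotomy (order x) (order y) with hlt | heq | hgt
    · exact ⟨m, hup.head ⟨hxy, hlt⟩, hdown⟩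
    · exact horder heq ▸ ⟨m, hup, hdown⟩
    · rcases hup.cases_head with rfl | ⟨z, ⟨hyz, hlt⟩, hzm⟩
      · exact ⟨x, .refl, hdown.head ⟨hxy, hgt⟩⟩
      · have hpath := hCH x y z hxy hyz hgt hlt
        clear hxy hgt
        induction hpath using ReflTransGen.head_induction_on with
        | refl => exact ⟨m, hzm, hdown⟩
        | head hab _ ihb => exact ih _ hab.2.2 hab.1 ihb

/-- Theorem 1 (correctness of Reachability Contraction Hierarchies).
`E` is the edge relation of a finite directed graph, `order` an injective numbering.
The hypothesis `hCH` abstracts the shortcut guarantee: whenever `⟨u,v,w⟩` is a path with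
`v` a local minimum of `order`, there is a path from `u` to `w` all of whose vertices have
order strictly larger than `order v`.  Then reachability is characterized by up-down paths. -/
theorem rch_up_down_characterization
    {V : Type*} [Fintype V] (E : V → V → Prop) (order : V → ℕ)
    (horder : Function.Injective order)
    (hCH : ∀ u v w : V, E u v → E v w → order v < order u → order v < order w →
      Relation.ReflTransGen (fun a b => E a b ∧ order v < order a ∧ order v < order b) u w) :
    ∀ s t : V, Relation.ReflTransGen E s t ↔
      ∃ m : V,
        Relation.ReflTransGen (fun a b => E a b ∧ order a < order b) s m ∧
        Relation.ReflTransGen (fun a b => E a b ∧ order b < order a) m t := by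
  intro s t
  constructor
  · intro h
    induction h using Relation.ReflTransGen.head_induction_on with
    | refl => exact ⟨t, .refl, .refl⟩
    | head hab _ ih => exact exists_up_down_of_edge horder hCH hab ih
  · rintro ⟨m, hup, hdown⟩
    exact (hup.lift id fun _ _ h => h.1).trans (hdown.lift id fun _ _ h => h.1)
end

section
/- Let G = (V,E) be a finite directed graph and let order : V → ℕ be an injective function such that for every vertex v, it is not the case that both (there exists u with order(u) > order(v) and (u,v) ∈ E) and (there exists w with order(w) > order(v) and (v,w) ∈ E); that is, every vertex is a source or a sink of the subgraph induced by the vertices of order at least its own. Then for all vertices s and t, s reaches t in G if and only if there exists a path ⟨s = u₁, …, u_k = m = w₁, …, w_ℓ = t⟩ in G with order(u₁) < ⋯ < order(u_k) and order(w₁) > ⋯ > order(w_ℓ). -/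
/-- Correctness of PReaCH's shortcut-free contraction hierarchies.
If, for every vertex `v`, it is not the case that `v` has both an in-neighbor and an
out-neighbor of larger order (i.e. every vertex is a source or a sink of the subgraph
induced by the vertices of order at least its own), then reachability is characterized
by up-down paths. -/
theorem shortcut_free_rch_up_down_characterization
    {V : Type*} [Fintype V] (E : V → V → Prop) (order : V → ℕ)
    (horder : Function.Injective order)
    (hSourceOrSink : ∀ v : V,
      ¬ ((∃ u : V, order v < order u ∧ E u v) ∧ (∃ w : V, order v < order w ∧ E v w))) :
    ∀ s t : V, Relation.ReflTransGen E s t ↔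
      ∃ m : V,
        Relation.ReflTransGen (fun a b => E a b ∧ order a < order b) s m ∧
        Relation.ReflTransGen (fun a b => E a b ∧ order b < order a) m t := by
  intro s t
  constructor
  · intro h
    induction h using Relation.ReflTransGen.head_induction_on with
    | refl => exact ⟨t, .refl, .refl⟩
    | @head a b hab _ ih =>
      obtain ⟨m, hup, hdown⟩ := ih
      rcases lt_trichotomy (order a) (order b) with hlt | heq | hgt
      · exact ⟨m, .head ⟨hab, hlt⟩ hup, hdown⟩
      · obtain rfl := horder heq
        exact ⟨m, hup, hdown⟩
      · rcases hup.cases_head with rfl | ⟨c, ⟨hbc, hlt⟩, _⟩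
        · exact ⟨a, .refl, .head ⟨hab, hgt⟩ hdown⟩
        · exact (hSourceOrSink b ⟨⟨a, hgt, hab⟩, ⟨c, hlt, hbc⟩⟩).elim
  · rintro ⟨m, hup, hdown⟩
    exact (Relation.ReflTransGen.mono (fun _ _ h => h.1) _ _ hup).trans
      (Relation.ReflTransGen.mono (fun _ _ h => h.1) _ _ hdown)
end

section
/- Let G = (V,E) be a finite directed graph, let φ : V → ℕ be injective, and let φ̂ : V → ℕ satisfy φ(v) ≤ φ̂(v) for all v. Suppose that for every vertex v and every vertex u ≠ v with φ(v) ≤ φ(u) ≤ φ̂(v), there exists an edge (p,u) ∈ E with φ(v) ≤ φ(p) < φ(u) and φ(u) ≤ φ̂(p). Then for all vertices v and t, if φ(v) ≤ φ(t) ≤ φ̂(v) then v reaches t in G. -/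
/-- Lemma 2 of the paper: positive pruning by DFS intervals.  `φ` plays the role of the
DFS number and `φ̂ v` the largest DFS number in the DFS subtree rooted at `v`.  The
hypothesis `hparent` is the defining property of DFS preorder intervals: every vertex `u ≠ v`
whose number lies in the interval of `v` has a tree-parent `p` with smaller number whose
interval contains `φ u`.  Then every `t` with `φ v ≤ φ t ≤ φ̂ v` is reachable from `v`. -/
theorem dfs_full_interval_reachable
    {V : Type*} [Fintype V] (E : V → V → Prop)
    (φ : V → ℕ) (φhat : V → ℕ)
    (hφ : Function.Injective φ)
    (hle : ∀ v : V, φ v ≤ φhat v)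
    (hparent : ∀ v u : V, u ≠ v → φ v ≤ φ u → φ u ≤ φhat v →
      ∃ p : V, E p u ∧ φ v ≤ φ p ∧ φ p < φ u ∧ φ u ≤ φhat p) :
    ∀ v t : V, φ v ≤ φ t → φ t ≤ φhat v → Relation.ReflTransGen E v t := by
  intro v t
  induction t using (measure φ).wf.induction with
  | _ t ih =>
    intro hvt htv
    by_cases h : t = v
    · exact h ▸ Relation.ReflTransGen.refl
    · obtain ⟨p, hE, hvp, hpt, -⟩ := hparent v t h hvt htv
      exact (ih p hpt hvp (hpt.le.trans htv)).tail hE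
end

section
/- Let G = (V,E) be a finite directed graph, let φ : V → ℕ be injective, and let φ̂ : V → ℕ satisfy φ(v) ≤ φ̂(v) for all v. Assume: (N) if φ(v) ≤ φ(w) ≤ φ̂(v) then φ̂(w) ≤ φ̂(v); (E) for every edge (u,w) ∈ E, φ(w) ≤ φ̂(u); and (C) for every edge (u,w) ∈ E with φ(w) < φ(u), φ̂(w) < φ(u). Then for all vertices v and t, if φ(t) > φ̂(v) then v does not reach t in G. -/
/-- Lemma 3 of the paper: no vertex with DFS number exceeding `φ̂ v` is reachable from `v`.
`φ` is the DFS number, `φ̂ v` the largest DFS number in the DFS subtree rooted at `v`.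
(N): intervals are nested; (E): every edge target is explored no later than the source
finishes; (C): cross/forward edges go to already-finished subtrees. -/
theorem dfs_upper_empty_interval
    {V : Type*} [Fintype V] (E : V → V → Prop)
    (φ : V → ℕ) (φhat : V → ℕ)
    (hφ : Function.Injective φ)
    (hle : ∀ v : V, φ v ≤ φhat v)
    (hN : ∀ v w : V, φ v ≤ φ w → φ w ≤ φhat v → φhat w ≤ φhat v)
    (hE : ∀ u w : V, E u w → φ w ≤ φhat u)
    (hC : ∀ u w : V, E u w → φ w < φ u → φhat w < φ u) :
    ∀ v t : V, φhat v < φ t → ¬ Relation.ReflTransGen E v t := by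
  intro v t hlt hvt
  have edge_le : ∀ u w : V, E u w → φhat w ≤ φhat u := fun u w huw =>
    (le_or_gt (φ u) (φ w)).elim (fun h => hN u w h (hE u w huw))
      (fun h => (hC u w huw h).le.trans (hle u))
  have path_le : φhat t ≤ φhat v := by
    clear hlt
    induction hvt with
    | refl => exact le_rfl
    | tail _ huw ih => exact (edge_le _ _ huw).trans ih
  exact absurd ((hle t).trans path_le) hlt.not_ge
end

section
/- Let G = (V,E) be a finite directed acyclic graph, let φ : V → ℕ be injective, and let f : V → ℕ be a function satisfying, for every vertex v, f(v) = min({φ(v)} ∪ {f(w) : (v,w) ∈ E}). Then for every vertex v, f(v) = min{φ(t) : v reaches t}; in other words, f(v) is the smallest φ-number of a vertex reachable from v. -/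
/-- On a finite type, the converse of an acyclic relation is well-founded. -/
theorem wellFounded_swap_of_acyclic {V : Type*} [Finite V] {E : V → V → Prop}
    (hacyclic : ∀ v : V, ¬ Relation.TransGen E v v) :
    WellFounded (fun w v => E v w) := by
  have : IsTrans V (fun w v => Relation.TransGen E v w) := ⟨fun _ _ _ h₁ h₂ => h₂.trans h₁⟩
  have : Std.Irrefl (fun w v => Relation.TransGen E v w) := ⟨hacyclic⟩
  exact Subrelation.wf (fun h => Relation.TransGen.single h)
    (Finite.wellFounded_of_trans_of_irrefl (fun w v => Relation.TransGen E v w))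

/-- Lemma 5 of the paper: the value `φ_min v`, computed bottom-up during a DFS of a finite
DAG by the recursion `f v = min ({φ v} ∪ {f w : (v,w) ∈ E})`, equals the smallest DFS
number of any vertex reachable from `v`. -/
theorem dfs_phi_min_correct
    {V : Type*} [Fintype V] (E : V → V → Prop)
    (hacyclic : ∀ v : V, ¬ Relation.TransGen E v v)
    (φ : V → ℕ) (hφ : Function.Injective φ)
    (f : V → ℕ)
    (hf : ∀ v : V, f v = sInf ({φ v} ∪ {n : ℕ | ∃ w : V, E v w ∧ f w = n})) :
    ∀ v : V, f v = sInf {n : ℕ | ∃ t : V, Relation.ReflTransGen E v t ∧ φ t = n} := by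
  have le_of_reach {v t : V} (h : Relation.ReflTransGen E v t) : f v ≤ φ t := by
    induction h using Relation.ReflTransGen.head_induction_on with
    | refl => rw [hf]; exact Nat.sInf_le (Or.inl rfl)
    | head hvw _ ih =>
      refine le_trans ?_ ih
      rw [hf]
      exact Nat.sInf_le (Or.inr ⟨_, hvw, rfl⟩)
  have attained (v : V) : ∃ t, Relation.ReflTransGen E v t ∧ φ t = f v := by
    induction v using (wellFounded_swap_of_acyclic hacyclic).induction with
    | _ v ih =>
      have hmem := Nat.sInf_mem (s := {φ v} ∪ {n : ℕ | ∃ w : V, E v w ∧ f w = n})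
        ⟨φ v, Or.inl rfl⟩
      rw [← hf v] at hmem
      rcases hmem with h | ⟨w, hvw, hw⟩
      · exact ⟨v, .refl, h.symm⟩
      · obtain ⟨t, hwt, ht⟩ := ih w hvw
        exact ⟨t, hwt.head hvw, ht.trans hw⟩
  intro v
  refine le_antisymm (le_csInf ⟨φ v, v, .refl, rfl⟩ ?_) (Nat.sInf_le (attained v))
  rintro _ ⟨t, ht, rfl⟩
  exact le_of_reach ht
end

section
/- Let G = (V,E) be a finite directed acyclic graph, let φ : V → ℕ be injective with φ(v) ≥ 1 for all v, and let φ̂ : V → ℕ satisfy φ(v) ≤ φ̂(v) for all v. Assume: (N) if φ(v) ≤ φ(w) ≤ φ̂(v) then φ̂(w) ≤ φ̂(v); (E) for every edge (u,w) ∈ E, φ(w) ≤ φ̂(u); and (C) for every edge (u,w) ∈ E with φ(w) < φ(u), φ̂(w) < φ(u). Let g : V → ℕ satisfy, for every vertex v, g(v) = max({0} ∪ {φ̂(w) : (v,w) ∈ E, φ(w) < φ(v)} ∪ {g(w) : (v,w) ∈ E}). Then for every vertex t with v reaching t and φ(t) < φ(v), one has φ(t) ≤ g(v); equivalently, the interval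 g(v)+1 .. φ(v)−1 contains no DFS number of a vertex reachable from v. -/
/-- The largest DFS number of a subtree does not increase along a directed path. -/
theorem phihat_le_of_reaches {V : Type*} {E : V → V → Prop} {φ φhat : V → ℕ}
    (hle : ∀ v : V, φ v ≤ φhat v)
    (hN : ∀ v w : V, φ v ≤ φ w → φ w ≤ φhat v → φhat w ≤ φhat v)
    (hE : ∀ u w : V, E u w → φ w ≤ φhat u)
    (hC : ∀ u w : V, E u w → φ w < φ u → φhat w < φ u)
    {u t : V} (h : Relation.ReflTransGen E u t) : φhat t ≤ φhat u := by
  induction h with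
  | refl => exact le_rfl
  | @tail b c _ hbc ih =>
    refine le_trans ?_ ih
    rcases lt_or_ge (φ c) (φ b) with hlt | hge
    · exact (hC b c hbc hlt).le.trans (hle b)
    · exact hN b c hge (hE b c hbc)


/-- Lemma 6 of the paper: the value `φ_gap v` computed by the recursion
`g v = max ({0} ∪ {φ̂ w : (v,w) ∈ E, φ w < φ v} ∪ {g w : (v,w) ∈ E})`
yields the empty range `g v + 1 .. φ v - 1`: every vertex `t` reachable from `v` with
`φ t < φ v` satisfies `φ t ≤ g v`.  Here `φ` is an injective DFS numbering with values
at least 1, `φ̂ v` the largest DFS number in the subtree rooted at `v`; (N) nestedness,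
(E) edge targets explored no later than the source finishes, (C) cross/forward edges go
to already-finished subtrees. -/
theorem dfs_phi_gap_correct
    {V : Type*} [Fintype V] (E : V → V → Prop)
    (hacyclic : ∀ v : V, ¬ Relation.TransGen E v v)
    (φ : V → ℕ) (φhat : V → ℕ)
    (hφ : Function.Injective φ)
    (hφ1 : ∀ v : V, 1 ≤ φ v)
    (hle : ∀ v : V, φ v ≤ φhat v)
    (hN : ∀ v w : V, φ v ≤ φ w → φ w ≤ φhat v → φhat w ≤ φhat v)
    (hE : ∀ u w : V, E u w → φ w ≤ φhat u)
    (hC : ∀ u w : V, E u w → φ w < φ u → φhat w < φ u)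
    (g : V → ℕ)
    (hg : ∀ v : V, g v =
      sSup ({0} ∪ {n : ℕ | ∃ w : V, E v w ∧ φ w < φ v ∧ φhat w = n}
        ∪ {n : ℕ | ∃ w : V, E v w ∧ g w = n})) :
    ∀ v t : V, Relation.ReflTransGen E v t → φ t < φ v → φ t ≤ g v := by
  intro v t h
  have hbdd (v : V) : BddAbove ({0} ∪ {n : ℕ | ∃ w : V, E v w ∧ φ w < φ v ∧ φhat w = n}
      ∪ {n : ℕ | ∃ w : V, E v w ∧ g w = n}) := by
    refine Set.Finite.bddAbove (((Set.finite_singleton 0).union ?_).union ?_)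
    · exact (Set.finite_range φhat).subset fun n ⟨w, _, _, hw⟩ => ⟨w, hw⟩
    · exact (Set.finite_range g).subset fun n ⟨w, _, hw⟩ => ⟨w, hw⟩
  induction h using Relation.ReflTransGen.head_induction_on with
  | refl => exact fun hlt => absurd hlt (lt_irrefl _)
  | @head u w huw hwt ih =>
    intro htu
    rw [hg u]
    rcases lt_or_ge (φ w) (φ u) with hlt | hge
    · exact ((hle t).trans (phihat_le_of_reaches hle hN hE hC hwt)).trans
        (le_csSup (hbdd u) (Or.inl (Or.inr ⟨w, huw, hlt, rfl⟩)))
    · exact (ih (htu.trans_le hge)).trans (le_csSup (hbdd u) (Or.inr ⟨w, huw, rfl⟩))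
end

section
/- Let G = (V,E) be a finite directed graph, let φ : V → ℕ be injective, and let φ̂ : V → ℕ satisfy φ(v) ≤ φ̂(v) for all v. Assume: (N) if φ(v) ≤ φ(w) ≤ φ̂(v) then φ̂(w) ≤ φ̂(v); and (E) for every edge (u,w) ∈ E, φ(w) ≤ φ̂(u). Then for every vertex v and every vertex w such that v reaches w and φ(w) ∉ [φ(v), φ̂(v)], there exists an edge (v,u) ∈ E such that u reaches w and either (φ(u) < φ(v) and φ(u) ≤ φ(w) ≤ φ̂(u)) or φ(w) ∉ [φ(u), φ̂(u)]. -/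
/-- The inductive decomposition underlying Lemma 4 of the paper.  `φ` is the DFS number,
`φ̂ v` the largest DFS number in the DFS subtree rooted at `v`, `range v = [φ v, φ̂ v]`;
(N) says the intervals are nested and (E) says every edge target is explored no later than
the source finishes.  If `v` reaches `w` and `φ w` lies outside `range v`, then some
out-neighbor `u` of `v` reaches `w` and either `φ u < φ v` with `φ w ∈ range u`, or
`φ w` lies outside `range u`. -/
theorem ptree_inductive_decomposition
    {V : Type*} [Fintype V] (E : V → V → Prop)
    (φ : V → ℕ) (φhat : V → ℕ)
    (hφ : Function.Injective φ)
    (hle : ∀ v : V, φ v ≤ φhat v)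
    (hN : ∀ v w : V, φ v ≤ φ w → φ w ≤ φhat v → φhat w ≤ φhat v)
    (hE : ∀ u w : V, E u w → φ w ≤ φhat u) :
    ∀ v w : V, Relation.ReflTransGen E v w → φ w ∉ Set.Icc (φ v) (φhat v) →
      ∃ u : V, E v u ∧ Relation.ReflTransGen E u w ∧
        ((φ u < φ v ∧ φ u ≤ φ w ∧ φ w ≤ φhat u) ∨ φ w ∉ Set.Icc (φ u) (φhat u)) := by
  intro v w hvw hw
  rcases hvw.cases_head with rfl | ⟨u, hvu, huw⟩
  · exact absurd ⟨le_rfl, hle v⟩ hw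
  · refine ⟨u, hvu, huw, ?_⟩
    by_cases hu : φ w ∈ Set.Icc (φ u) (φhat u)
    · left
      refine ⟨?_, hu.1, hu.2⟩
      by_contra! hvu_le
      exact hw ⟨hvu_le.trans hu.1, hu.2.trans (hN v u hvu_le (hE v u hvu))⟩
    · exact Or.inr hu
end

section
/- Let G = (V,E) be a finite directed graph and let order : V → ℕ be an injective function with the property that for all vertices u, v, w with (u,v) ∈ E, (v,w) ∈ E, order(v) < order(u) and order(v) < order(w), there exists a directed path from u to w in G all of whose vertices have order strictly greater than order(v). Call an internal vertex v of a path P a local minimum of P if its predecessor u and successor w on P satisfy order(v) < order(u) and order(v) < order(w). Then for every path P from s to t that has at least one local minimum, letting v be a local minimum of P of smallest order, there exists a path P' from s to t in G such that every local minimum of P' has order strictly greater than order(v). -/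
/-- Position `i` of the list of vertices `p` is a local minimum of the path `p` with
respect to the numbering `order`: it is an internal position and the order of the vertex
there is smaller than the orders of its predecessor and successor on the path. -/
def IsPathLocalMin {V : Type*} (order : V → ℕ) (p : List V) (i : Fin p.length) : Prop :=
  0 < i.val ∧ ∃ h2 : i.val + 1 < p.length,
    order (p.get i) <
      order (p.get ⟨i.val - 1, Nat.lt_of_le_of_lt (Nat.sub_le _ _) i.isLt⟩) ∧
    order (p.get i) < order (p.get ⟨i.val + 1, h2⟩)

/-- A local minimum is the middle of three consecutive vertices of the path. -/
theorem IsPathLocalMin.exists_infix_triple {V : Type*} {order : V → ℕ} {p : List V}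
    {i : Fin p.length}
    (h : IsPathLocalMin order p i) :
    ∃ a c, [a, p.get i, c] <:+: p ∧ order (p.get i) < order a ∧ order (p.get i) < order c := by
  obtain ⟨h0, h2, ha, hc⟩ := h
  refine ⟨_, _, ?_, ha, hc⟩
  rw [List.infix_iff_getElem?]
  refine ⟨i.val - 1, by simp; omega, fun j hj => ?_⟩
  have hj' : j < 3 := hj
  interval_cases j <;> simp <;> grind

/-- The middle of three consecutive vertices of `A ++ u :: v :: w :: B` is a local minimum
as soon as its order is smaller than those of its neighbours. -/
theorem isPathLocalMin_of_eq_append {V : Type*} {order : V → ℕ} {A B p : List V} {u v w : V}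
    (hp : p = A ++ u :: v :: w :: B) (hu : order v < order u) (hw : order v < order w) :
    ∃ i : Fin p.length, IsPathLocalMin order p i ∧ p.get i = v := by
  subst hp
  refine ⟨⟨A.length + 1, by simp⟩, ⟨by simp, by simp; omega, ?_, ?_⟩, ?_⟩
  · simpa using hu
  · have h : (A ++ u :: v :: w :: B)[A.length + 1 + 1]? = some w := by grind
    simpa [(List.getElem?_eq_some_iff.1 h).2] using hw
  · simp

/-- Three consecutive elements of `A ++ q ++ B` whose middle is not in `q` lie on one side
of `q`, up to its endpoints. -/
theorem List.triple_infix_of_middle_notMem {V : Type*} {A B q : List V} {a b c u w : V}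
    (hu : q.head? = some u) (hw : q.getLast? = some w) (hb : b ∉ q)
    (h : [a, b, c] <:+: A ++ q ++ B) :
    [a, b, c] <:+: A ++ [u] ∨ [a, b, c] <:+: w :: B := by
  obtain ⟨S, T, h⟩ := h
  have h1 : S ++ [a] ++ ([b, c] ++ T) = A ++ (q ++ B) := by simpa using h
  rcases List.append_eq_append_iff.1 h1 with ⟨X, hA, hX⟩ | ⟨X, hS, hX⟩
  · cases X with
    | nil => cases q <;> simp_all
    | cons x X =>
      left
      obtain ⟨rfl, hX⟩ : b = x ∧ c :: T = X ++ (q ++ B) := by simpa using hX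
      refine ⟨S, (X ++ [u]).tail, ?_⟩
      cases X <;> cases q <;> simp_all
  · rcases List.append_eq_append_iff.1 hX with ⟨Y, hY, hB⟩ | ⟨Y, hY, hB⟩
    · right
      rcases List.eq_nil_or_concat Y with rfl | ⟨Y, y, rfl⟩
      · have hX' : X = q := by simpa using hY
        subst hX'
        obtain ⟨X, x, rfl⟩ := (List.eq_nil_or_concat X).resolve_left (by rintro rfl; simp at hu)
        refine ⟨[], T, ?_⟩
        simp_all [← List.append_assoc]
      · obtain ⟨-, rfl⟩ : S = A ++ (q ++ Y) ∧ a = y := by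
          simpa [hY, ← List.append_assoc] using hS
        exact ⟨w :: Y, T, by simp [hB]⟩
    · cases Y with
      | nil =>
        right
        have hX' : X = q := by simpa using hY.symm
        subst hX'
        obtain ⟨X, x, rfl⟩ := (List.eq_nil_or_concat X).resolve_left (by rintro rfl; simp at hu)
        refine ⟨[], T, ?_⟩
        simp_all [← List.append_assoc]
      | cons y Y => simp_all

/-- If all local minima of a path have order at least `k`, then the path can be replaced by one
with the same endpoints all of whose local minima have order greater than `k`. -/
theorem exists_path_localMin_gt {V : Type*} (E : V → V → Prop) (order : V → ℕ) (k : ℕ)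
    (hCH : ∀ u v w : V, E u v → E v w → order v < order u → order v < order w →
      Relation.ReflTransGen (fun a b => E a b ∧ order v < order a ∧ order v < order b) u w)
    (s t : V) (p : List V)
    (hchain : p.IsChain E) (hhead : p.head? = some s) (hlast : p.getLast? = some t)
    (hmin : ∀ a b c, [a, b, c] <:+: p → order b < order a → order b < order c → k ≤ order b) :
    ∃ p' : List V, p'.IsChain E ∧ p'.head? = some s ∧ p'.getLast? = some t ∧
      ∀ a b c, [a, b, c] <:+: p' → order b < order a → order b < order c → k < order b := by
  induction hn : p.countP (order · = k) using Nat.strong_induction_on generalizing p with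
  | _ n ih =>
  subst hn
  by_cases hall : ∀ a b c, [a, b, c] <:+: p → order b < order a → order b < order c → k < order b
  · exact ⟨p, hchain, hhead, hlast, hall⟩
  push Not at hall
  obtain ⟨u, v, w, hp, hu, hw, hk⟩ := hall
  obtain rfl : k = order v := le_antisymm (hmin u v w hp hu hw) hk
  obtain ⟨A, B, rfl⟩ := hp
  have huvw : [u, v, w].IsChain E := hchain.left_of_append.right_of_append
  simp only [List.isChain_cons_cons, List.isChain_singleton, and_true] at huvw
  obtain ⟨q, hq, hqc, hqu, hqw⟩ : ∃ q : List V, (∀ x ∈ q, order v < order x) ∧ q.IsChain E ∧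
      q.head? = some u ∧ q.getLast? = some w := by
    obtain ⟨l, hl, hlw⟩ := List.exists_isChain_cons_of_relationReflTransGen
      (hCH u v w huvw.1 huvw.2 hu hw)
    refine ⟨u :: l, ?_, hl.imp fun _ _ h => h.1, rfl, ?_⟩
    · exact hl.induction (order v < order ·) _ (fun _ _ h _ => h.2.2) (by simpa using hu)
    · rw [List.getLast?_eq_getLast_of_ne_nil (by simp), hlw]
  refine ih _ ?_ (A ++ q ++ B) ?_ ?_ ?_ ?_ rfl
  · have : q.countP (order · = order v) = 0 := by
      rw [List.countP_eq_zero]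
      intro x hx
      simpa using (hq x hx).ne'
    simp [List.countP_append, List.countP_cons, this]
    omega
  · simp only [List.isChain_append, hqu] at hchain ⊢
    refine ⟨⟨hchain.1.1, hqc, by simpa using hchain.1.2.2⟩, hchain.2.1, ?_⟩
    simpa [List.getLast?_append, hqw] using hchain.2.2
  · cases A <;> simp_all
  · simpa [List.getLast?_append, List.getLast?_cons, hqw] using hlast
  · intro a b c habc hba hbc
    by_cases hb : b ∈ q
    · exact (hq b hb).le
    refine hmin a b c ?_ hba hbc
    rcases List.triple_infix_of_middle_notMem hqu hqw hb habc with h | h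
    · exact h.trans ⟨[], v :: w :: B, by simp⟩
    · exact h.trans ⟨A ++ [u, v], [], by simp⟩

/-- Inductive step in the proof of Theorem 1 of the paper: under the contraction-hierarchy
property, any `s`-`t` path with at least one local minimum can be replaced, choosing a
local minimum `v` of smallest order, by an `s`-`t` path all of whose local minima have
order strictly greater than `order v`. -/
theorem eliminate_lowest_local_minimum
    {V : Type*} [Fintype V] (E : V → V → Prop) (order : V → ℕ)
    (horder : Function.Injective order)
    (hCH : ∀ u v w : V, E u v → E v w → order v < order u → order v < order w →
      Relation.ReflTransGen (fun a b => E a b ∧ order v < order a ∧ order v < order b) u w)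
    (s t : V) (p : List V)
    (hchain : p.Chain' E) (hhead : p.head? = some s) (hlast : p.getLast? = some t)
    (i₀ : Fin p.length) (hi₀ : IsPathLocalMin order p i₀)
    (hsmallest : ∀ j : Fin p.length, IsPathLocalMin order p j →
      order (p.get i₀) ≤ order (p.get j)) :
    ∃ p' : List V, p'.Chain' E ∧ p'.head? = some s ∧ p'.getLast? = some t ∧
      ∀ j : Fin p'.length, IsPathLocalMin order p' j →
        order (p.get i₀) < order (p'.get j) := by
  obtain ⟨p', hc, hh, hl, hm⟩ := exists_path_localMin_gt E order (order (p.get i₀)) hCH s t p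
    hchain hhead hlast fun a b c ⟨A, B, h⟩ ha hc => by
      obtain ⟨i, hi, rfl⟩ := isPathLocalMin_of_eq_append (A := A) (B := B)
        (p := p) (by simpa using h.symm) ha hc
      exact hsmallest i hi
  refine ⟨p', hc, hh, hl, fun j hj => ?_⟩
  obtain ⟨a, c, h, ha, hc⟩ := hj.exists_infix_triple
  exact hm _ _ _ h ha hc
end
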